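/- arXiv:1511.03860 — 3 statements merged into one kernel-verified Lean document; each statement's English description precedes it below -/
import Mathlib

section
/- For every set S of positive integers with 1 ∈ S there is a constant C > 0 such that for all x ≥ 3, |#{n ≤ x : n ∈ E(S)} − H(S)·x| ≤ C·√x·(log x)·exp(c·√(log x)/log log x), where c = 4·√(2.4/log 2). -/
open scoped Classical

/-- `charFn S` is the characteristic function `u` of a set `S` of positive integers. -/
noncomputable def charFn (S : Set ℕ) (n : ℕ) : ℝ := if n ∈ S then 1 else 0

/-- `H S = ∏_p (1 + Σ_{i ≥ 2} (u(i) - u(i-1)) / p^i)`, the product over all primes. -/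
noncomputable def H (S : Set ℕ) : ℝ :=
  ∏' p : Nat.Primes,
    (1 + ∑' i : ℕ, (charFn S (i + 2) - charFn S (i + 1)) / ((p : ℕ) : ℝ) ^ (i + 2))

/-- The exponentially `S`-numbers: positive integers all of whose prime-factorization
exponents lie in `S`. -/
def ExpS (S : Set ℕ) : Set ℕ :=
  {N | 0 < N ∧ ∀ p : ℕ, p.Prime → p ∣ N → N.factorization p ∈ S}

/-- The set `D` of all densities `H S` as `S` ranges over sets of positive integers
containing `1`. -/
noncomputable def densitySet : Set ℝ :=
  {x | ∃ S : Set ℕ, 1 ∈ S ∧ (∀ n ∈ S, 0 < n) ∧ H S = x}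

open scoped ArithmeticFunction.zeta ArithmeticFunction.Moebius

/-- A positive integer in which every prime factor has exponent at least two is of the form
`a ^ 2 * b ^ 3`. -/
theorem exists_sq_mul_cube {n : ℕ} (hn : 0 < n)
    (h : ∀ p : ℕ, p.Prime → p ∣ n → p ^ 2 ∣ n) :
    ∃ a b : ℕ, 0 < a ∧ 0 < b ∧ n = a ^ 2 * b ^ 3 := by
  obtain ⟨b, c, hb, hc, hbc, hsq⟩ := Nat.sq_mul_squarefree_of_pos hn
  have hdvd : b ∣ c := by
    rw [← Nat.prod_primeFactors_of_squarefree hsq]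
    refine (Finset.prod_dvd_prod_of_subset _ _ _ fun p hpb => ?_).trans
      (Nat.prod_primeFactors_dvd c)
    have hp := Nat.prime_of_mem_primeFactors hpb
    have hpb := Nat.dvd_of_mem_primeFactors hpb
    refine Nat.mem_primeFactors.mpr ⟨hp, ?_, hc.ne'⟩
    by_contra hpc
    have hcop : (p ^ 2).Coprime (c ^ 2) :=
      Nat.Coprime.pow 2 2 ((Nat.Prime.coprime_iff_not_dvd hp).mpr hpc)
    have hdvd := h p hp (hbc ▸ hpb.mul_left _)
    rw [← hbc] at hdvd
    have := hsq p (sq p ▸ hcop.dvd_of_dvd_mul_left hdvd)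
    exact hp.one_lt.ne' (Nat.isUnit_iff.mp this)
  obtain ⟨a, rfl⟩ := hdvd
  exact ⟨a, b, Nat.pos_of_mul_pos_left hc, hb, by rw [← hbc]; ring⟩

theorem sum_min_one_div_sq_le {t : ℝ} (ht : 0 < t) (N : ℕ) :
    ∑ a ∈ Finset.Icc 1 N, min 1 (t ^ 2 / (a : ℝ) ^ 2) ≤ 4 * t := by
  have key : ∀ N : ℕ, ∑ a ∈ Finset.Icc 1 N, min 1 (t ^ 2 / (a : ℝ) ^ 2) ≤
      4 * t * (N / (N + t)) := by
    intro N
    induction N with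
    | zero => simp
    | succ N ih =>
      rw [Finset.sum_Icc_succ_top (by lia)]
      have hN : (0 : ℝ) ≤ N := N.cast_nonneg
      have hstep : min 1 (t ^ 2 / ((N + 1 : ℕ) : ℝ) ^ 2) ≤
          4 * t * ((N + 1 : ℕ) / ((N + 1 : ℕ) + t)) - 4 * t * (N / (N + t)) := by
        push_cast
        have e : 4 * t * (((N : ℝ) + 1) / (N + 1 + t)) - 4 * t * (N / (N + t)) =
            4 * t ^ 2 / ((N + 1 + t) * (N + t)) := by
          field_simp
          ring
        rw [e]
        rcases le_total (N + 1 : ℝ) t with h | h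
        · refine (min_le_left _ _).trans ?_
          rw [le_div_iff₀ (by positivity)]
          nlinarith
        · refine (min_le_right _ _).trans ?_
          rw [div_le_div_iff₀ (by positivity) (by positivity)]
          have : ((N : ℝ) + 1 + t) * (N + t) ≤ 4 * (N + 1) ^ 2 := by nlinarith
          nlinarith [sq_nonneg t]
      linarith
  refine (key N).trans ?_
  have hN : (0 : ℝ) ≤ N := N.cast_nonneg
  have : (N : ℝ) / (N + t) ≤ 1 := by
    rw [div_le_one (by positivity)]
    linarith
  nlinarith

theorem sum_min_one_div_powerful_le (T : Finset ℕ) (hT : ∀ n ∈ T, 0 < n)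
    (hT' : ∀ n ∈ T, ∀ p : ℕ, p.Prime → p ∣ n → p ^ 2 ∣ n) {x : ℝ} (hx : 0 < x) :
    ∑ n ∈ T, min 1 (x / (n : ℝ)) ≤
      4 * (∑' b : ℕ, 1 / (b : ℝ) ^ (3 / 2 : ℝ)) * √x := by
  set N := T.sup id
  set P := Finset.Icc 1 N ×ˢ Finset.Icc 1 N
  have hsub : T ⊆ P.image fun q : ℕ × ℕ => q.1 ^ 2 * q.2 ^ 3 := by
    intro n hn
    obtain ⟨a, b, ha, hb, rfl⟩ := exists_sq_mul_cube (hT n hn) (hT' n hn)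
    have hN : a ^ 2 * b ^ 3 ≤ N := Finset.le_sup (f := id) hn
    have h1 : a ≤ a ^ 2 * b ^ 3 := by
      calc a ≤ a ^ 2 := Nat.le_self_pow two_ne_zero a
        _ ≤ _ := Nat.le_mul_of_pos_right _ (by positivity)
    have h2 : b ≤ a ^ 2 * b ^ 3 := by
      calc b ≤ b ^ 3 := Nat.le_self_pow three_ne_zero b
        _ ≤ _ := Nat.le_mul_of_pos_left _ (by positivity)
    refine Finset.mem_image.mpr ⟨(a, b), ?_, rfl⟩
    simp only [P, Finset.mem_product, Finset.mem_Icc]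
    lia
  have hnonneg : ∀ n : ℕ, 0 ≤ min 1 (x / (n : ℝ)) := fun n => le_min zero_le_one (by positivity)
  have hsummable : Summable fun b : ℕ => 1 / (b : ℝ) ^ (3 / 2 : ℝ) :=
    Real.summable_one_div_nat_rpow.mpr (by norm_num)
  calc ∑ n ∈ T, min 1 (x / (n : ℝ))
      ≤ ∑ n ∈ P.image fun q : ℕ × ℕ => q.1 ^ 2 * q.2 ^ 3, min 1 (x / (n : ℝ)) :=
        Finset.sum_le_sum_of_subset_of_nonneg hsub fun n _ _ => hnonneg n
    _ ≤ ∑ q ∈ P, min 1 (x / ((q.1 ^ 2 * q.2 ^ 3 : ℕ) : ℝ)) :=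
        Finset.sum_image_le_of_nonneg fun n _ => hnonneg n
    _ = ∑ b ∈ Finset.Icc 1 N, ∑ a ∈ Finset.Icc 1 N, min 1 (x / ((a ^ 2 * b ^ 3 : ℕ) : ℝ)) :=
        Finset.sum_product_right _ _ _
    _ ≤ ∑ b ∈ Finset.Icc 1 N, 4 * (√x * (1 / (b : ℝ) ^ (3 / 2 : ℝ))) := by
        refine Finset.sum_le_sum fun b hb => ?_
        have hb' : (0 : ℝ) < b := by exact_mod_cast (Finset.mem_Icc.mp hb).1
        refine le_trans (le_of_eq ?_)
          (sum_min_one_div_sq_le (t := √x * (1 / (b : ℝ) ^ (3 / 2 : ℝ))) (by positivity) N)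
        refine Finset.sum_congr rfl fun a _ => ?_
        have hpow : ((b : ℝ) ^ (3 / 2 : ℝ)) ^ 2 = (b : ℝ) ^ 3 := by
          rw [← Real.rpow_natCast, ← Real.rpow_mul hb'.le, ← Real.rpow_natCast]
          norm_num
        rw [mul_pow, Real.sq_sqrt hx.le, div_pow, hpow]
        push_cast
        congr 1
        rw [one_pow, mul_one_div, div_div, mul_comm ((b : ℝ) ^ 3)]
    _ = 4 * (∑ b ∈ Finset.Icc 1 N, 1 / (b : ℝ) ^ (3 / 2 : ℝ)) * √x := by
        rw [Finset.mul_sum, Finset.sum_mul]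
        exact Finset.sum_congr rfl fun b _ => by ring
    _ ≤ _ := by
        gcongr
        exact hsummable.sum_le_tsum _ fun b _ => by positivity

/-- The indicator function of the exponentially `S`-numbers. -/
noncomputable def expSIndicator (S : Set ℕ) : ArithmeticFunction ℝ :=
  ⟨fun n => if n ∈ ExpS S then 1 else 0, by simp [ExpS]⟩

theorem expSIndicator_apply (S : Set ℕ) (n : ℕ) :
    expSIndicator S n = if n ∈ ExpS S then 1 else 0 := rfl

theorem mul_mem_expS_iff {S : Set ℕ} {m n : ℕ} (hm : m ≠ 0) (hn : n ≠ 0) (h : m.Coprime n) :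
    m * n ∈ ExpS S ↔ m ∈ ExpS S ∧ n ∈ ExpS S := by
  have hl : ∀ p : ℕ, p.Prime → p ∣ m → (m * n).factorization p = m.factorization p :=
    fun p hp hpm => Nat.factorization_eq_of_coprime_left h
      ((Nat.mem_primeFactorsList hm).mpr ⟨hp, hpm⟩)
  have hr : ∀ p : ℕ, p.Prime → p ∣ n → (m * n).factorization p = n.factorization p :=
    fun p hp hpn => Nat.factorization_eq_of_coprime_right h
      ((Nat.mem_primeFactorsList hn).mpr ⟨hp, hpn⟩)
  constructor
  · rintro ⟨-, hmn⟩
    refine ⟨⟨hm.bot_lt, fun p hp hpm => ?_⟩, ⟨hn.bot_lt, fun p hp hpn => ?_⟩⟩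
    · rw [← hl p hp hpm]
      exact hmn p hp (hpm.mul_right n)
    · rw [← hr p hp hpn]
      exact hmn p hp (hpn.mul_left m)
  · rintro ⟨⟨-, hm'⟩, ⟨-, hn'⟩⟩
    refine ⟨Nat.mul_pos hm.bot_lt hn.bot_lt, fun p hp hpmn => ?_⟩
    rcases hp.dvd_mul.mp hpmn with hpm | hpn
    · rw [hl p hp hpm]
      exact hm' p hp hpm
    · rw [hr p hp hpn]
      exact hn' p hp hpn

theorem expSIndicator_isMultiplicative (S : Set ℕ) : (expSIndicator S).IsMultiplicative := by
  rw [ArithmeticFunction.IsMultiplicative.iff_ne_zero]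
  refine ⟨?_, fun {m n} hm hn h => ?_⟩
  · rw [expSIndicator_apply, if_pos]
    exact ⟨one_pos, fun p hp hp1 => absurd hp1 hp.not_dvd_one⟩
  · simp only [expSIndicator_apply, mul_mem_expS_iff hm hn h]
    by_cases h₁ : m ∈ ExpS S <;> by_cases h₂ : n ∈ ExpS S <;> simp [h₁, h₂]

theorem expSIndicator_prime_pow_succ (S : Set ℕ) {p : ℕ} (hp : p.Prime) (k : ℕ) :
    expSIndicator S (p ^ (k + 1)) = charFn S (k + 1) := by
  have : p ^ (k + 1) ∈ ExpS S ↔ k + 1 ∈ S := by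
    constructor
    · rintro ⟨-, h⟩
      simpa [hp.factorization_self] using h p hp (dvd_pow_self p k.succ_ne_zero)
    · intro h
      refine ⟨pow_pos hp.pos _, fun q hq hqp => ?_⟩
      obtain rfl := (Nat.prime_dvd_prime_iff_eq hq hp).mp (hq.dvd_of_dvd_pow hqp)
      simpa [hp.factorization_self] using h
  simp [expSIndicator_apply, charFn, this]

/-- The Möbius transform of the indicator function of the exponentially `S`-numbers. -/
noncomputable def expSMoebius (S : Set ℕ) : ArithmeticFunction ℝ :=
  expSIndicator S * (μ : ArithmeticFunction ℝ)

theorem expSMoebius_mul_zeta (S : Set ℕ) :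
    expSMoebius S * (ζ : ArithmeticFunction ℝ) = expSIndicator S := by
  rw [expSMoebius, mul_assoc, ArithmeticFunction.coe_moebius_mul_coe_zeta, mul_one]

theorem expSMoebius_isMultiplicative (S : Set ℕ) : (expSMoebius S).IsMultiplicative :=
  (expSIndicator_isMultiplicative S).mul ArithmeticFunction.isMultiplicative_moebius.intCast

theorem expSMoebius_prime_pow_succ (S : Set ℕ) {p : ℕ} (hp : p.Prime) (k : ℕ) :
    expSMoebius S (p ^ (k + 1)) = expSIndicator S (p ^ (k + 1)) - expSIndicator S (p ^ k) := by
  have h : ∀ j, expSIndicator S (p ^ j) = ∑ i ∈ Finset.range (j + 1), expSMoebius S (p ^ i) := by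
    intro j
    rw [← expSMoebius_mul_zeta, ArithmeticFunction.coe_mul_zeta_apply,
      Nat.sum_divisors_prime_pow hp]
  rw [h, h, Finset.sum_range_succ _ (k + 1)]
  ring

theorem expSMoebius_prime {S : Set ℕ} (h1 : 1 ∈ S) {p : ℕ} (hp : p.Prime) :
    expSMoebius S p = 0 := by
  have h := expSMoebius_prime_pow_succ S hp 0
  rw [expSIndicator_prime_pow_succ S hp, pow_zero, (expSIndicator_isMultiplicative S).1] at h
  simpa [charFn, h1] using h

theorem abs_expSMoebius_le_one (S : Set ℕ) (n : ℕ) : |expSMoebius S n| ≤ 1 := by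
  rcases eq_or_ne n 0 with rfl | hn
  · simp
  rw [(expSMoebius_isMultiplicative S).multiplicative_factorization _ hn, Finsupp.prod,
    Finset.abs_prod]
  refine Finset.prod_le_one (fun _ _ => abs_nonneg _) fun p hp => ?_
  have hp' : p.Prime := Nat.prime_of_mem_primeFactors hp
  obtain ⟨k, hk⟩ := Nat.exists_eq_succ_of_ne_zero (Finsupp.mem_support_iff.mp hp)
  rw [hk, Nat.succ_eq_add_one, expSMoebius_prime_pow_succ S hp', expSIndicator_apply,
    expSIndicator_apply]
  split_ifs <;> norm_num

theorem sq_dvd_of_expSMoebius_ne_zero {S : Set ℕ} (h1 : 1 ∈ S) {n : ℕ}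
    (h : expSMoebius S n ≠ 0) {p : ℕ} (hp : p.Prime) (hpn : p ∣ n) : p ^ 2 ∣ n := by
  by_contra hsq
  obtain ⟨m, rfl⟩ := hpn
  have hm : p.Coprime m := (Nat.Prime.coprime_iff_not_dvd hp).mpr fun hpm =>
    hsq (by rw [sq]; exact mul_dvd_mul_left p hpm)
  rw [(expSMoebius_isMultiplicative S).2 hm, expSMoebius_prime h1 hp, zero_mul] at h
  exact h rfl

theorem sum_abs_expSMoebius_mul_min_le {S : Set ℕ} (h1 : 1 ∈ S) {x : ℝ} (hx : 0 < x)
    (T : Finset ℕ) :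
    ∑ n ∈ T, |expSMoebius S n| * min 1 (x / (n : ℝ)) ≤
      4 * (∑' b : ℕ, 1 / (b : ℝ) ^ (3 / 2 : ℝ)) * √x := by
  rw [← Finset.sum_filter_of_ne (p := fun n => expSMoebius S n ≠ 0)
    (fun n _ hn h => hn (by rw [h, abs_zero, zero_mul]))]
  refine le_trans (Finset.sum_le_sum fun n _ => ?_) (sum_min_one_div_powerful_le
    (T.filter fun n => expSMoebius S n ≠ 0) (fun n hn => ?_) (fun n hn p hp hpn => ?_) hx)
  · exact mul_le_of_le_one_left (le_min zero_le_one (by positivity)) (abs_expSMoebius_le_one S n)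
  · rw [pos_iff_ne_zero]
    rintro rfl
    simp at hn
  · exact sq_dvd_of_expSMoebius_ne_zero h1 (Finset.mem_filter.mp hn).2 hp hpn

theorem summable_norm_expSMoebius_div {S : Set ℕ} (h1 : 1 ∈ S) :
    Summable fun n : ℕ => ‖expSMoebius S n / (n : ℝ)‖ := by
  refine summable_of_sum_le (fun _ => norm_nonneg _) fun T =>
    le_trans (le_of_eq (Finset.sum_congr rfl fun n _ => ?_))
      (sum_abs_expSMoebius_mul_min_le h1 one_pos T)
  rcases eq_or_ne n 0 with rfl | hn
  · simp
  · have hn' : (1 : ℝ) ≤ n := by exact_mod_cast Nat.one_le_iff_ne_zero.mpr hn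
    rw [min_eq_right ((div_le_one (by positivity)).mpr hn'), Real.norm_eq_abs, abs_div,
      Nat.abs_cast, mul_one_div]

theorem tsum_expSMoebius_div {S : Set ℕ} (h1 : 1 ∈ S) :
    ∑' n : ℕ, expSMoebius S n / (n : ℝ) = H S := by
  have hsum := summable_norm_expSMoebius_div h1
  have hprod := EulerProduct.eulerProduct_hasProd (f := fun n : ℕ => expSMoebius S n / (n : ℝ))
    (by simp [(expSMoebius_isMultiplicative S).1])
    (fun {m n} h => by
      rw [(expSMoebius_isMultiplicative S).2 h, Nat.cast_mul, mul_div_mul_comm])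
    hsum (by simp)
  rw [← hprod.tprod_eq, H]
  refine tprod_congr fun p => ?_
  have hp := p.2
  have hs : Summable fun e : ℕ =>
      expSMoebius S ((p : ℕ) ^ e) / (((p : ℕ) ^ e : ℕ) : ℝ) :=
    hsum.of_norm.comp_injective (Nat.pow_right_injective hp.two_le)
  rw [← hs.sum_add_tsum_nat_add 2, Finset.sum_range_succ, Finset.sum_range_one]
  simp only [pow_zero, pow_one, (expSMoebius_isMultiplicative S).1, expSMoebius_prime h1 hp,
    Nat.cast_one, div_one, zero_div, add_zero]
  congr 1
  refine tsum_congr fun i => ?_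
  rw [expSMoebius_prime_pow_succ S hp, expSIndicator_prime_pow_succ S hp,
    expSIndicator_prime_pow_succ S hp, Nat.cast_pow]

theorem card_expS_eq_sum (S : Set ℕ) (x : ℕ) :
    (((Finset.Icc 1 x).filter (fun n => n ∈ ExpS S)).card : ℝ) =
      ∑ n ∈ Finset.Ioc 0 x, expSMoebius S n * ((x / n : ℕ) : ℝ) := by
  rw [← ArithmeticFunction.sum_Ioc_mul_zeta_eq_sum, expSMoebius_mul_zeta]
  simp only [expSIndicator_apply, Finset.sum_boole]
  rfl

theorem abs_natDiv_sub_div_le (x n : ℕ) :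
    |((x / n : ℕ) : ℝ) - (x : ℝ) / n| ≤ min 1 ((x : ℝ) / n) := by
  have h₁ : ((x / n : ℕ) : ℝ) ≤ (x : ℝ) / n := Nat.cast_div_le
  have h₂ : (x : ℝ) / n < ((x / n : ℕ) : ℝ) + 1 := by
    rw [← Nat.floor_div_eq_div (K := ℝ)]
    exact Nat.lt_floor_add_one _
  have h₃ : (0 : ℝ) ≤ ((x / n : ℕ) : ℝ) := Nat.cast_nonneg _
  rw [abs_sub_comm, abs_of_nonneg (by linarith)]
  exact le_min (by linarith) (by linarith)

/-- The counting function of the exponentially `S`-numbers is `H S * x + O(√x)`. -/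
theorem abs_card_expS_sub_le {S : Set ℕ} (h1 : 1 ∈ S) {x : ℕ} (hx : 0 < x) :
    |(((Finset.Icc 1 x).filter (fun n => n ∈ ExpS S)).card : ℝ) - H S * (x : ℝ)| ≤
      4 * (∑' b : ℕ, 1 / (b : ℝ) ^ (3 / 2 : ℝ)) * √(x : ℝ) := by
  have hcount : HasSum (fun n : ℕ => expSMoebius S n * ((x / n : ℕ) : ℝ))
      (((Finset.Icc 1 x).filter (fun n => n ∈ ExpS S)).card : ℝ) := by
    rw [card_expS_eq_sum]
    refine hasSum_sum_of_ne_finset_zero fun n hn => ?_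
    rcases eq_or_ne n 0 with rfl | hn0
    · simp
    · rw [Nat.div_eq_of_lt (by rw [Finset.mem_Ioc] at hn; lia), Nat.cast_zero, mul_zero]
  have hmain : HasSum (fun n : ℕ => expSMoebius S n / (n : ℝ) * (x : ℝ)) (H S * (x : ℝ)) := by
    rw [← tsum_expSMoebius_div h1]
    exact (summable_norm_expSMoebius_div h1).of_norm.hasSum.mul_right _
  refine le_of_tendsto (hcount.sub hmain).abs (Filter.Eventually.of_forall fun T => ?_)
  refine (Finset.abs_sum_le_sum_abs _ _).trans (le_trans (Finset.sum_le_sum fun n _ => ?_)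
    (sum_abs_expSMoebius_mul_min_le h1 (Nat.cast_pos.mpr hx) T))
  rw [div_mul_eq_mul_div, mul_div_assoc, ← mul_sub, abs_mul]
  exact mul_le_mul_of_nonneg_left (abs_natDiv_sub_div_le x n) (abs_nonneg _)

theorem expS_count_error (S : Set ℕ) (h1 : 1 ∈ S) (hpos : ∀ n ∈ S, 0 < n) :
    ∃ C : ℝ, 0 < C ∧ ∀ x : ℕ, 3 ≤ x →
      |(((Finset.Icc 1 x).filter (fun n => n ∈ ExpS S)).card : ℝ) - H S * (x : ℝ)| ≤
        C * Real.sqrt (x : ℝ) * Real.log (x : ℝ) *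
          Real.exp (4 * Real.sqrt (2.4 / Real.log 2) *
            Real.sqrt (Real.log (x : ℝ)) / Real.log (Real.log (x : ℝ))) := by
  set K : ℝ := 4 * ∑' b : ℕ, 1 / (b : ℝ) ^ (3 / 2 : ℝ)
  have hK : 0 ≤ K := mul_nonneg zero_le_four (tsum_nonneg fun b => by positivity)
  refine ⟨K + 1, by linarith, fun x hx => (abs_card_expS_sub_le h1 (by lia)).trans ?_⟩
  have hlog : 1 ≤ Real.log (x : ℝ) := by
    rw [Real.le_log_iff_exp_le (by positivity)]
    have : (3 : ℝ) ≤ x := by exact_mod_cast hx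
    linarith [Real.exp_one_lt_d9]
  have hexp : 1 ≤ Real.exp (4 * Real.sqrt (2.4 / Real.log 2) *
      Real.sqrt (Real.log (x : ℝ)) / Real.log (Real.log (x : ℝ))) :=
    Real.one_le_exp (div_nonneg (by positivity) (Real.log_nonneg hlog))
  calc K * √(x : ℝ) ≤ (K + 1) * √(x : ℝ) := by gcongr; linarith
    _ ≤ (K + 1) * √(x : ℝ) * Real.log (x : ℝ) := le_mul_of_one_le_right (by positivity) hlog
    _ ≤ _ := le_mul_of_one_le_right (by positivity) hexp
end

section
/- Let S = {s(1) < s(2) < s(3) < ...} be an infinite set of positive integers with s(1) = 1, and for each n ≥ 1 let S_n = {s(1), ..., s(n)} be the set of its n smallest elements. Then H(S_n) → H(S) as n → ∞. -/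
open scoped Classical

theorem abs_charFn_sub_charFn_le_one (S : Set ℕ) (m n : ℕ) : |charFn S m - charFn S n| ≤ 1 := by
  unfold charFn
  split_ifs <;> simp

/-- The characteristic functions of the initial segments of a sequence converge pointwise to
the characteristic function of its range. -/
theorem tendsto_charFn_image_Iio (s : ℕ → ℕ) (m : ℕ) :
    Filter.Tendsto (fun n : ℕ => charFn (s '' Set.Iio n) m) Filter.atTop
      (nhds (charFn (Set.range s) m)) := by
  refine tendsto_nhds_of_eventually_eq ?_
  by_cases hm : m ∈ Set.range s
  · obtain ⟨k, rfl⟩ := hm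
    filter_upwards [Filter.eventually_gt_atTop k] with n hn
    rw [charFn, charFn, if_pos (Set.mem_image_of_mem s (Set.mem_Iio.mpr hn)),
      if_pos (Set.mem_range_self k)]
  · refine Filter.Eventually.of_forall fun n => ?_
    rw [charFn, charFn, if_neg hm, if_neg fun h => hm (Set.image_subset_range _ _ h)]

theorem norm_charFn_sub_div_pow_le (S : Set ℕ) {x : ℝ} (hx : 2 ≤ x) (i : ℕ) :
    ‖(charFn S (i + 2) - charFn S (i + 1)) / x ^ (i + 2)‖ ≤ (x ^ 2)⁻¹ * (1 / 2) ^ i := by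
  have hx0 : 0 < x := by linarith
  rw [norm_div, norm_pow, Real.norm_eq_abs, Real.norm_of_nonneg hx0.le]
  calc |charFn S (i + 2) - charFn S (i + 1)| / x ^ (i + 2)
      ≤ 1 / (2 ^ i * x ^ 2) := by
        rw [pow_add]
        gcongr
        exact abs_charFn_sub_charFn_le_one S _ _
    _ = (x ^ 2)⁻¹ * (1 / 2) ^ i := by
        rw [one_div_pow]
        field_simp

theorem summable_nat_primes_inv_sq_mul_two :
    Summable fun p : Nat.Primes => (((p : ℕ) : ℝ) ^ 2)⁻¹ * 2 :=
  ((Real.summable_nat_pow_inv.mpr one_lt_two).comp_injective Subtype.val_injective).mul_right 2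

theorem tendsto_H_partial (s : ℕ → ℕ) (hmono : StrictMono s) (hs0 : s 0 = 1) :
    Filter.Tendsto (fun n : ℕ => H (s '' Set.Iio n)) Filter.atTop
      (nhds (H (Set.range s))) := by
  have two_le (p : Nat.Primes) : (2 : ℝ) ≤ ((p : ℕ) : ℝ) := mod_cast p.2.two_le
  refine tendsto_tprod_one_add_of_dominated_convergence summable_nat_primes_inv_sq_mul_two
    (fun p => ?_) (Filter.Eventually.of_forall fun n p => ?_)
  · exact tendsto_tsum_of_dominated_convergence (summable_geometric_two.mul_left _)
      (fun i => ((tendsto_charFn_image_Iio s _).sub (tendsto_charFn_image_Iio s _)).div_const _)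
      (Filter.Eventually.of_forall fun n i => norm_charFn_sub_div_pow_le _ (two_le p) i)
  · exact tsum_of_norm_bounded (hasSum_geometric_two.mul_left _)
      fun i => norm_charFn_sub_div_pow_le _ (two_le p) i
end

section
/- Let A and B be distinct sets of positive integers with 1 ∈ A and 1 ∈ B, and let s* be the smallest positive integer belonging to exactly one of A, B (the minimum of the symmetric difference). If s* ∈ A, then H(A) > H(B). -/
open scoped Classical

lemma charFn_nonneg (S : Set ℕ) (n : ℕ) : 0 ≤ charFn S n := by
  unfold charFn; split_ifs <;> norm_num

lemma charFn_le_one (S : Set ℕ) (n : ℕ) : charFn S n ≤ 1 := by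
  unfold charFn; split_ifs <;> norm_num

lemma summable_charFn_mul_pow (S : Set ℕ) {x : ℝ} (hx0 : 0 ≤ x) (hx1 : x < 1) (k : ℕ) :
    Summable fun i : ℕ ↦ charFn S (i + k) * x ^ (i + k) :=
  Summable.of_nonneg_of_le (fun _ ↦ mul_nonneg (charFn_nonneg S _) (pow_nonneg hx0 _))
    (fun _ ↦ mul_le_of_le_one_left (pow_nonneg hx0 _) (charFn_le_one S _))
    ((summable_nat_add_iff k).2 (summable_geometric_of_lt_one hx0 hx1))

lemma tsum_geometric_tail {x : ℝ} (hx0 : 0 ≤ x) (hx1 : x < 1) (k : ℕ) :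
    ∑' i : ℕ, x ^ (i + k) = x ^ k / (1 - x) := by
  simp_rw [pow_add, tsum_mul_right, tsum_geometric_of_lt_one hx0 hx1]
  ring

/-- The Euler factor of `H S` at `p` is `1 + eulerTerm S (1 / p)`. -/
noncomputable def eulerTerm (S : Set ℕ) (x : ℝ) : ℝ :=
  ∑' i : ℕ, (charFn S (i + 2) - charFn S (i + 1)) * x ^ (i + 2)

lemma eulerTerm_eq {S : Set ℕ} (h1 : 1 ∈ S) {x : ℝ} (hx0 : 0 ≤ x) (hx1 : x < 1) :
    eulerTerm S x = (1 - x) * ∑' i : ℕ, charFn S (i + 2) * x ^ (i + 2) - x ^ 2 := by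
  have h : ∑' i : ℕ, charFn S (i + 1) * x ^ (i + 1) =
      x + ∑' i : ℕ, charFn S (i + 2) * x ^ (i + 2) := by
    rw [(summable_charFn_mul_pow S hx0 hx1 1).tsum_eq_zero_add]
    simp [charFn, h1]
  have hterm (i : ℕ) : (charFn S (i + 2) - charFn S (i + 1)) * x ^ (i + 2) =
      charFn S (i + 2) * x ^ (i + 2) - x * (charFn S (i + 1) * x ^ (i + 1)) := by ring
  rw [eulerTerm, tsum_congr hterm, (summable_charFn_mul_pow S hx0 hx1 2).tsum_sub
    ((summable_charFn_mul_pow S hx0 hx1 1).mul_left x), tsum_mul_left, h]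
  ring

lemma neg_sq_le_eulerTerm {S : Set ℕ} (h1 : 1 ∈ S) {x : ℝ} (hx0 : 0 ≤ x) (hx1 : x < 1) :
    -x ^ 2 ≤ eulerTerm S x := by
  have : 0 ≤ ∑' i : ℕ, charFn S (i + 2) * x ^ (i + 2) :=
    tsum_nonneg fun i ↦ mul_nonneg (charFn_nonneg S _) (pow_nonneg hx0 _)
  rw [eulerTerm_eq h1 hx0 hx1]
  nlinarith

lemma eulerTerm_nonpos {S : Set ℕ} (h1 : 1 ∈ S) {x : ℝ} (hx0 : 0 ≤ x) (hx1 : x < 1) :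
    eulerTerm S x ≤ 0 := by
  have h : ∑' i : ℕ, charFn S (i + 2) * x ^ (i + 2) ≤ x ^ 2 / (1 - x) := by
    rw [← tsum_geometric_tail hx0 hx1]
    exact (summable_charFn_mul_pow S hx0 hx1 2).tsum_le_tsum
      (fun i ↦ mul_le_of_le_one_left (pow_nonneg hx0 _) (charFn_le_one S _))
      ((summable_nat_add_iff 2).2 (summable_geometric_of_lt_one hx0 hx1))
  rw [le_div_iff₀ (by linarith)] at h
  rw [eulerTerm_eq h1 hx0 hx1]
  linarith

lemma le_eulerTerm_sub {A B : Set ℕ} (h1A : 1 ∈ A) (h1B : 1 ∈ B) {k : ℕ}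
    (hA : k + 2 ∈ A) (hB : k + 2 ∉ B) (hmin : ∀ m < k + 2, (m ∈ A ↔ m ∈ B))
    {x : ℝ} (hx0 : 0 ≤ x) (hx1 : x < 1) :
    x ^ (k + 2) * (1 - 2 * x) ≤ eulerTerm A x - eulerTerm B x := by
  set d : ℕ → ℝ := fun i ↦ charFn A (i + 2) * x ^ (i + 2) - charFn B (i + 2) * x ^ (i + 2)
    with hd
  have hsA := summable_charFn_mul_pow A hx0 hx1 2
  have hsB := summable_charFn_mul_pow B hx0 hx1 2
  have hsd : Summable d := hsA.sub hsB
  have hhead : ∑ i ∈ Finset.range (k + 1), d i = x ^ (k + 2) := by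
    rw [Finset.sum_range_succ, Finset.sum_eq_zero]
    · simp [hd, charFn, hA, hB]
    · intro i hi
      have := hmin (i + 2) (by have := Finset.mem_range.1 hi; omega)
      simp [hd, charFn, this]
  have htail : -(x ^ (k + 3) / (1 - x)) ≤ ∑' i, d (i + (k + 1)) := by
    rw [← tsum_geometric_tail hx0 hx1, ← tsum_neg]
    refine Summable.tsum_le_tsum (fun i ↦ ?_)
      ((summable_nat_add_iff (k + 3)).2 (summable_geometric_of_lt_one hx0 hx1)).neg
      ((summable_nat_add_iff (k + 1)).2 hsd)
    have hp : 0 ≤ x ^ (i + (k + 3)) := pow_nonneg hx0 _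
    have h0 := charFn_nonneg A (i + (k + 3))
    have h1 := charFn_le_one B (i + (k + 3))
    change _ ≤ charFn A (i + (k + 3)) * x ^ (i + (k + 3)) -
      charFn B (i + (k + 3)) * x ^ (i + (k + 3))
    nlinarith
  have hsum := hsd.sum_add_tsum_nat_add (k + 1)
  rw [hhead, hsA.tsum_sub hsB] at hsum
  rw [← neg_div, div_le_iff₀ (by linarith)] at htail
  rw [eulerTerm_eq h1A hx0 hx1, eulerTerm_eq h1B hx0 hx1]
  have hpow : x ^ (k + 3) = x ^ (k + 2) * x := pow_succ _ _
  linear_combination htail + (1 - x) * hsum + hpow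

lemma Nat.Primes.inv_le_half (p : Nat.Primes) : ((p : ℕ) : ℝ)⁻¹ ≤ 1 / 2 := by
  have : (2 : ℝ) ≤ (p : ℕ) := by exact_mod_cast p.2.two_le
  rw [← one_div]
  gcongr

lemma one_add_eulerTerm_pos {S : Set ℕ} (h1 : 1 ∈ S) (p : Nat.Primes) :
    0 < 1 + eulerTerm S ((p : ℕ) : ℝ)⁻¹ := by
  have hx0 : (0 : ℝ) ≤ ((p : ℕ) : ℝ)⁻¹ := by positivity
  have hx := p.inv_le_half
  have := neg_sq_le_eulerTerm h1 hx0 (by linarith)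
  nlinarith

lemma summable_log_one_add_eulerTerm {S : Set ℕ} (h1 : 1 ∈ S) :
    Summable fun p : Nat.Primes ↦ Real.log (1 + eulerTerm S ((p : ℕ) : ℝ)⁻¹) := by
  refine Real.summable_log_one_add_of_summable ?_
  have hsq : Summable fun p : Nat.Primes ↦ (((p : ℕ) : ℝ)⁻¹) ^ 2 := by
    have := (Real.summable_nat_pow_inv (p := 2)).2 one_lt_two
    simpa only [Function.comp_def, inv_pow] using
      this.comp_injective (i := fun p : Nat.Primes ↦ (p : ℕ)) Subtype.val_injective
  refine Summable.of_norm_bounded hsq fun p ↦ ?_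
  have hx0 : (0 : ℝ) ≤ ((p : ℕ) : ℝ)⁻¹ := by positivity
  have hx := p.inv_le_half
  rw [Real.norm_eq_abs, abs_of_nonpos (eulerTerm_nonpos h1 hx0 (by linarith))]
  linarith [neg_sq_le_eulerTerm h1 hx0 (by linarith)]

lemma H_eq_exp_tsum_log {S : Set ℕ} (h1 : 1 ∈ S) :
    H S = Real.exp (∑' p : Nat.Primes, Real.log (1 + eulerTerm S ((p : ℕ) : ℝ)⁻¹)) := by
  rw [Real.rexp_tsum_eq_tprod (one_add_eulerTerm_pos h1) (summable_log_one_add_eulerTerm h1)]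
  simp only [H, eulerTerm, div_eq_mul_inv, inv_pow]

theorem H_lt_of_min_symmDiff (A B : Set ℕ) (h1A : 1 ∈ A) (h1B : 1 ∈ B)
    (hposA : ∀ n ∈ A, 0 < n) (hposB : ∀ n ∈ B, 0 < n)
    (s : ℕ) (hsA : s ∈ A) (hsB : s ∉ B)
    (hmin : ∀ m : ℕ, m < s → (m ∈ A ↔ m ∈ B)) :
    H B < H A := by
  obtain ⟨k, rfl⟩ : ∃ k, s = k + 2 := by
    have h0 := hposA s hsA
    have h1 : s ≠ 1 := by rintro rfl; exact hsB h1B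
    exact ⟨s - 2, by omega⟩
  have hdiff (p : Nat.Primes) := le_eulerTerm_sub h1A h1B hsA hsB hmin
    (x := ((p : ℕ) : ℝ)⁻¹) (by positivity) (by linarith [p.inv_le_half])
  rw [H_eq_exp_tsum_log h1A, H_eq_exp_tsum_log h1B, Real.exp_lt_exp]
  refine Summable.tsum_lt_tsum (i := ⟨3, Nat.prime_three⟩) (fun p ↦ ?_) ?_
    (summable_log_one_add_eulerTerm h1B) (summable_log_one_add_eulerTerm h1A)
  · refine Real.log_le_log (one_add_eulerTerm_pos h1B p) ?_
    have h : 0 ≤ (((p : ℕ) : ℝ)⁻¹) ^ (k + 2) * (1 - 2 * ((p : ℕ) : ℝ)⁻¹) :=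
      mul_nonneg (by positivity) (by linarith [p.inv_le_half])
    linarith [hdiff p]
  · refine Real.log_lt_log (one_add_eulerTerm_pos h1B _) ?_
    have h : 0 < ((3 : ℝ)⁻¹) ^ (k + 2) * (1 - 2 * (3 : ℝ)⁻¹) :=
      mul_pos (by positivity) (by norm_num)
    have h3 := hdiff ⟨3, Nat.prime_three⟩
    push_cast at h3 ⊢
    linarith
end
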